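/- arXiv:1908.09331 — 2 statements merged into one kernel-verified Lean document; each statement's English description precedes it below -/
import Mathlib

section
/- Let α, β ≥ 0 with α + β > 1. There exists a constant C > 0, depending only on α and β, such that for every m ∈ ℤ², Σ_{l∈ℤ², |l| ≥ 2|m|} (1+|m−l|²)^{-α}·(1+|l|²)^{-β} ≤ C·(1+|m|²)^{1−α−β}. -/
open scoped BigOperators

/-- Squared Euclidean norm of a lattice point of `ℤ²`. -/
noncomputable def nsq (m : ℤ × ℤ) : ℝ := (m.1 : ℝ) ^ 2 + (m.2 : ℝ) ^ 2

/-- Euclidean norm of a lattice point of `ℤ²`. -/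
noncomputable def norm2 (m : ℤ × ℤ) : ℝ := Real.sqrt (nsq m)

lemma nsq_nonneg (m : ℤ × ℤ) : 0 ≤ nsq m := by unfold nsq; positivity

lemma summable_base (γ : ℝ) (hγ : 1 < γ) :
    Summable (fun q : ℤ × ℤ => (1 + nsq q) ^ (-γ)) := by
  have h := EisensteinSeries.summable_one_div_norm_rpow (k := 2 * γ) (by linarith)
  rw [← (finTwoArrowEquiv ℤ).symm.summable_iff] at h
  refine h.of_norm_bounded_eventually ?_
  have h0 : ∀ᶠ q : ℤ × ℤ in Filter.cofinite, q ≠ 0 := by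
    exact (Set.finite_singleton (0 : ℤ × ℤ)).compl_mem_cofinite
  filter_upwards [h0] with q hq
  have hpos : 0 < 1 + nsq q := by linarith [nsq_nonneg q]
  rw [Real.norm_of_nonneg (Real.rpow_nonneg hpos.le _)]
  simp only [Function.comp]
  set x := (finTwoArrowEquiv ℤ).symm q with hx
  have hx0 : x ≠ 0 := by
    intro h
    apply hq
    have h1 := congrFun h 0
    have h2 := congrFun h 1
    simp [hx] at h1 h2
    exact Prod.ext h1 h2
  have hn : 0 < ‖x‖ := norm_pos_iff.mpr hx0
  have hle : ‖x‖ ^ 2 ≤ 1 + nsq q := by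
    have : ‖x‖ ≤ Real.sqrt (1 + nsq q) := by
      refine (pi_norm_le_iff_of_nonneg (Real.sqrt_nonneg _)).mpr ?_
      intro i
      apply Real.le_sqrt_of_sq_le
      fin_cases i
      · simp [hx, Int.norm_eq_abs, nsq]; nlinarith [sq_nonneg (q.2 : ℝ)]
      · simp [hx, Int.norm_eq_abs, nsq]; nlinarith [sq_nonneg (q.1 : ℝ)]
    calc ‖x‖ ^ 2 ≤ (Real.sqrt (1 + nsq q)) ^ 2 := by gcongr
      _ = _ := Real.sq_sqrt hpos.le
  have e : ‖x‖ ^ (-(2 * γ)) = (‖x‖ ^ 2) ^ (-γ) := by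
    rw [← Real.rpow_natCast, ← Real.rpow_mul hn.le]; congr 1; push_cast; ring
  rw [e]
  exact Real.rpow_le_rpow_of_nonpos (by positivity) hle (by linarith)

lemma hasSum_div (F : ℤ × ℤ → ℝ) (hF : Summable F) (h0 : ∀ q, 0 ≤ F q) (N : ℕ) [NeZero N] :
    HasSum (fun l : ℤ × ℤ => F (l.1 / N, l.2 / N)) ((∑' q, F q) * (N : ℝ) ^ 2) := by
  have h1 : HasSum (fun _ : Fin N × Fin N => (1 : ℝ)) ((N : ℝ) ^ 2) := by
    convert hasSum_fintype (fun _ : Fin N × Fin N => (1 : ℝ)) using 1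
    simp [sq]
  have h2 := hF.hasSum.mul h1 (hF.mul_of_nonneg h1.summable h0 (fun _ => zero_le_one))
  let e : ℤ × ℤ ≃ (ℤ × ℤ) × (Fin N × Fin N) :=
    ((Int.divModEquiv N).prodCongr (Int.divModEquiv N)).trans (Equiv.prodProdProdComm _ _ _ _)
  have h3 := e.hasSum_iff.mpr h2
  have h4 : (fun l : ℤ × ℤ => F (l.1 / N, l.2 / N)) =
      (fun x : (ℤ × ℤ) × (Fin N × Fin N) => F x.1 * 1) ∘ e := by
    funext l
    simp [e, Int.divModEquiv]
  rw [h4]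
  exact h3

lemma div_bound (N : ℕ) (hN : 0 < N) (a : ℤ) :
    (N : ℝ) ^ 2 * ((a / (N : ℤ) : ℤ) : ℝ) ^ 2 ≤ 2 * (a : ℝ) ^ 2 + 2 * (N : ℝ) ^ 2 := by
  have h1 := Int.mul_ediv_add_emod a N
  have h2 := Int.emod_nonneg a (b := (N : ℤ)) (by omega)
  have h3 := Int.emod_lt_of_pos a (b := (N : ℤ)) (by omega)
  have h1' : (N : ℝ) * ((a / (N : ℤ) : ℤ) : ℝ) + ((a % (N : ℤ) : ℤ) : ℝ) = a := by exact_mod_cast h1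
  have h2' : (0 : ℝ) ≤ ((a % (N : ℤ) : ℤ) : ℝ) := by exact_mod_cast h2
  have h3' : ((a % (N : ℤ) : ℤ) : ℝ) ≤ N := by exact_mod_cast h3.le
  set q := ((a / (N : ℤ) : ℤ) : ℝ)
  set r := ((a % (N : ℤ) : ℤ) : ℝ)
  have e : (N : ℝ) * q = a - r := by linarith
  rw [← mul_pow, e]
  nlinarith [sq_nonneg ((a : ℝ) + r)]

theorem stmt_5 (α β : ℝ) (hα : 0 ≤ α) (hβ : 0 ≤ β) (hαβ : 1 < α + β) :
    ∃ C : ℝ, 0 < C ∧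
      ∀ m : ℤ × ℤ,
        (∑' l : ℤ × ℤ,
            Set.indicator {l : ℤ × ℤ | 2 * norm2 m ≤ norm2 l}
              (fun l => (1 + nsq (m - l)) ^ (-α) * (1 + nsq l) ^ (-β)) l)
          ≤ C * (1 + nsq m) ^ (1 - α - β) := by
  set F : ℤ × ℤ → ℝ := fun q => (1 + nsq q) ^ (-(α + β)) with hFdef
  have hF : Summable F := summable_base _ hαβ
  have hp : ∀ q, 0 < 1 + nsq q := fun q => by linarith [nsq_nonneg q]
  have hF0 : ∀ q, 0 < F q := fun q => Real.rpow_pos_of_pos (hp q) _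
  have hS : 0 < ∑' q, F q := hF.tsum_pos (fun q => (hF0 q).le) 0 (hF0 0)
  set K : ℝ := (1 / 4 : ℝ) ^ (-α) * (1 / 20 : ℝ) ^ (-(α + β)) with hK
  have hK0 : 0 < K := by positivity
  refine ⟨K * ∑' q, F q, by positivity, fun m => ?_⟩
  obtain ⟨N, hN0, hN1, hN2⟩ : ∃ N : ℕ, 0 < N ∧ 1 + nsq m ≤ (N : ℝ) ^ 2 ∧
      (N : ℝ) ^ 2 ≤ 4 * (1 + nsq m) := by
    have hs1 : 1 ≤ Real.sqrt (1 + nsq m) := Real.one_le_sqrt.mpr (by linarith [nsq_nonneg m])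
    have hs2 := Real.sq_sqrt (hp m).le
    have ha := Nat.le_ceil (Real.sqrt (1 + nsq m))
    have hb := Nat.ceil_lt_add_one (Real.sqrt_nonneg (1 + nsq m))
    refine ⟨⌈Real.sqrt (1 + nsq m)⌉₊, Nat.ceil_pos.mpr (by linarith), ?_, ?_⟩ <;> nlinarith
  haveI : NeZero N := ⟨hN0.ne'⟩
  have hNR : (0 : ℝ) < (N : ℝ) ^ 2 := by positivity
  have hsum := (hasSum_div F hF (fun q => (hF0 q).le) N).mul_left (K * ((N : ℝ) ^ 2) ^ (-(α + β)))
  have hle : ∀ l : ℤ × ℤ, Set.indicator {l : ℤ × ℤ | 2 * norm2 m ≤ norm2 l}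
      (fun l => (1 + nsq (m - l)) ^ (-α) * (1 + nsq l) ^ (-β)) l ≤
      K * ((N : ℝ) ^ 2) ^ (-(α + β)) * F (l.1 / N, l.2 / N) := by
    intro l
    by_cases hl : l ∈ {l : ℤ × ℤ | 2 * norm2 m ≤ norm2 l}
    · rw [Set.indicator_of_mem hl]
      have hl' : 4 * nsq m ≤ nsq l := by
        have h1 : 2 * norm2 m ≤ norm2 l := hl
        have h2 : norm2 m ^ 2 = nsq m := Real.sq_sqrt (nsq_nonneg m)
        have h3 : norm2 l ^ 2 = nsq l := Real.sq_sqrt (nsq_nonneg l)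
        have h4 : 0 ≤ norm2 m := Real.sqrt_nonneg _
        nlinarith
      have hA : 1 / 4 * (1 + nsq l) ≤ 1 + nsq (m - l) := by
        have : nsq l / 2 - nsq m ≤ nsq (m - l) := by
          simp only [nsq, Prod.fst_sub, Prod.snd_sub, Int.cast_sub]
          nlinarith [sq_nonneg (2 * (m.1 : ℝ) - l.1), sq_nonneg (2 * (m.2 : ℝ) - l.2)]
        linarith
      have hB : 1 / 20 * ((N : ℝ) ^ 2 * (1 + nsq (l.1 / N, l.2 / N))) ≤ 1 + nsq l := by
        have h1 := div_bound N hN0 l.1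
        have h2 := div_bound N hN0 l.2
        have h3 := nsq_nonneg l
        simp only [nsq] at *
        nlinarith
      have hq := hp (l.1 / N, l.2 / N)
      calc (1 + nsq (m - l)) ^ (-α) * (1 + nsq l) ^ (-β)
          ≤ (1 / 4 * (1 + nsq l)) ^ (-α) * (1 + nsq l) ^ (-β) := by
            refine mul_le_mul_of_nonneg_right ?_ (Real.rpow_nonneg (hp l).le _)
            exact Real.rpow_le_rpow_of_nonpos (by linarith [hp l]) hA (by linarith)
        _ = (1 / 4 : ℝ) ^ (-α) * (1 + nsq l) ^ (-(α + β)) := by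
            rw [Real.mul_rpow (by norm_num) (hp l).le, mul_assoc, ← Real.rpow_add (hp l)]
            congr 2; ring
        _ ≤ (1 / 4 : ℝ) ^ (-α) *
            (1 / 20 * ((N : ℝ) ^ 2 * (1 + nsq (l.1 / N, l.2 / N)))) ^ (-(α + β)) := by
            refine mul_le_mul_of_nonneg_left ?_ (by positivity)
            exact Real.rpow_le_rpow_of_nonpos (by positivity) hB (by linarith)
        _ = _ := by
            rw [Real.mul_rpow (by norm_num) (by positivity), Real.mul_rpow hNR.le hq.le, hK]
            simp only [hFdef]; ring
    · rw [Set.indicator_of_notMem hl]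
      have := hF0 (l.1 / N, l.2 / N)
      positivity
  have hnn : ∀ l : ℤ × ℤ, 0 ≤ Set.indicator {l : ℤ × ℤ | 2 * norm2 m ≤ norm2 l}
      (fun l => (1 + nsq (m - l)) ^ (-α) * (1 + nsq l) ^ (-β)) l := fun l =>
    Set.indicator_nonneg (fun l _ => mul_nonneg (Real.rpow_nonneg (hp _).le _)
      (Real.rpow_nonneg (hp _).le _)) l
  have hfs := Summable.of_nonneg_of_le hnn hle hsum.summable
  calc _ ≤ _ := hfs.tsum_le_tsum hle hsum.summable
    _ = K * (∑' q, F q) * ((N : ℝ) ^ 2) ^ (1 - α - β) := by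
        rw [hsum.tsum_eq]
        have : ((N : ℝ) ^ 2) ^ (1 - α - β) = ((N : ℝ) ^ 2) ^ (-(α + β)) * (N : ℝ) ^ 2 := by
          rw [← Real.rpow_add_one hNR.ne']; congr 1; ring
        rw [this]; ring
    _ ≤ _ := by
        refine mul_le_mul_of_nonneg_left ?_ (by positivity)
        exact Real.rpow_le_rpow_of_nonpos (hp m) hN1 (by linarith)
end

section
/- Let n ≥ 2 be an integer and let K⁰ : ℤ² → (0,∞) be the kernel K⁰(m) = (1+|m|²)^{−1}. Then for all λ > 0 and ε > 0 with λ + ε < 1 there exists a constant C > 0, depending only on n, λ, ε, such that for every N ≥ 1 and every m ∈ ℤ², K⁰⋆ⁿ_{>N}K⁰(m) ≤ C·(1+N²)^{−λ}·(1+|m|²)^{λ+ε−1}. -/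
open scoped BigOperators

/-- Convolution of two kernels on `ℤ²`: `K₁⋆K₂(m) = Σ_{l∈ℤ²} K₁(m−l)K₂(l)`. -/
noncomputable def conv (K₁ K₂ : ℤ × ℤ → ℝ) (m : ℤ × ℤ) : ℝ :=
  ∑' l : ℤ × ℤ, K₁ (m - l) * K₂ l

/-- Truncated convolution: `K₁⋆_{≤N}K₂(m) = Σ_{|l|≤N} K₁(m−l)K₂(l)`. -/
noncomputable def convLE (N : ℕ) (K₁ K₂ : ℤ × ℤ → ℝ) (m : ℤ × ℤ) : ℝ :=
  ∑' l : ℤ × ℤ,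
    Set.indicator {l : ℤ × ℤ | norm2 l ≤ (N : ℝ)} (fun l => K₁ (m - l) * K₂ l) l

/-- Iterated convolution `K⋆ⁿK`, with `K⋆¹K = K` and `K⋆ⁿK = K⋆(K⋆ⁿ⁻¹K)`. -/
noncomputable def iterConv (K : ℤ × ℤ → ℝ) : ℕ → ℤ × ℤ → ℝ
  | 0 => fun _ => 0
  | 1 => K
  | (n + 2) => conv K (iterConv K (n + 1))

/-- Truncated iterated convolution `K⋆ⁿ_{≤N}K`, with `K⋆¹_{≤N}K = K` and
`K⋆ⁿ_{≤N}K = K⋆_{≤N}(K⋆ⁿ⁻¹_{≤N}K)`. -/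
noncomputable def iterConvLE (N : ℕ) (K : ℤ × ℤ → ℝ) : ℕ → ℤ × ℤ → ℝ
  | 0 => fun _ => 0
  | 1 => K
  | (n + 2) => convLE N K (iterConvLE N K (n + 1))

/-- Tail of the iterated convolution: `K⋆ⁿ_{>N}K = K⋆ⁿK − K⋆ⁿ_{≤N}K`. -/
noncomputable def iterConvGT (N : ℕ) (K : ℤ × ℤ → ℝ) (n : ℕ) (m : ℤ × ℤ) : ℝ :=
  iterConv K n m - iterConvLE N K n m

lemma aux_one_le (m : ℤ × ℤ) : 1 ≤ 1 + nsq m := by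
  unfold nsq; nlinarith [sq_nonneg (m.1 : ℝ), sq_nonneg (m.2 : ℝ)]

lemma aux_pos (m : ℤ × ℤ) : 0 < 1 + nsq m := lt_of_lt_of_le one_pos (aux_one_le m)

lemma aux_sum_int (s : ℝ) (hs : 1 < 2 * s) :
    Summable (fun x : ℤ => (1 + (x : ℝ) ^ 2) ^ (-s)) := by
  have h := Real.summable_abs_int_rpow hs
  refine Summable.of_norm_bounded_eventually h ?_
  have : ∀ᶠ x : ℤ in Filter.cofinite, x ≠ 0 := (Set.finite_singleton (0 : ℤ)).compl_mem_cofinite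
  filter_upwards [this] with x hx
  have hx' : 0 < |(x : ℝ)| := by positivity
  have h1 : |(x : ℝ)| ^ (-(2 * s)) = ((x : ℝ) ^ 2) ^ (-s) := by
    rw [← sq_abs, ← Real.rpow_natCast, ← Real.rpow_mul hx'.le]
    congr 1; push_cast; ring
  rw [h1, Real.norm_of_nonneg (by positivity)]
  apply Real.rpow_le_rpow_of_nonpos (by positivity) (by linarith) (by linarith)

lemma aux_sum (s : ℝ) (hs : 1 < s) :
    Summable (fun l : ℤ × ℤ => (1 + nsq l) ^ (-s)) := by
  have h1 := aux_sum_int (s / 2) (by linarith)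
  have h2 := h1.mul_of_nonneg h1 (fun x => by positivity) (fun x => by positivity)
  refine Summable.of_nonneg_of_le (fun l => Real.rpow_nonneg (aux_pos l).le _) (fun l => ?_) h2
  have hp := aux_pos l
  have e : (1 + nsq l) ^ (-s) = ((1 + nsq l) ^ 2) ^ (-(s / 2)) := by
    rw [← Real.rpow_natCast, ← Real.rpow_mul hp.le]
    congr 1; push_cast; ring
  rw [e, ← Real.mul_rpow (by positivity) (by positivity)]
  apply Real.rpow_le_rpow_of_nonpos (by positivity) _ (by linarith)
  unfold nsq
  nlinarith [sq_nonneg (l.1 : ℝ), sq_nonneg (l.2 : ℝ),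
    mul_nonneg (sq_nonneg (l.1 : ℝ)) (sq_nonneg (l.2 : ℝ))]

lemma aux_young (A B p q : ℝ) (hA : 0 < A) (hB : 0 < B) (hp : 0 ≤ p) (hq : 0 ≤ q) :
    A ^ (-p) * B ^ (-q) ≤ A ^ (-(p + q)) + B ^ (-(p + q)) := by
  rcases le_total A B with h | h
  · have : B ^ (-q) ≤ A ^ (-q) := Real.rpow_le_rpow_of_nonpos hA h (by linarith)
    calc A ^ (-p) * B ^ (-q) ≤ A ^ (-p) * A ^ (-q) := by gcongr
      _ = A ^ (-(p + q)) := by rw [← Real.rpow_add hA]; congr 1; ring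
      _ ≤ _ := by linarith [Real.rpow_nonneg hB.le (-(p + q))]
  · have : A ^ (-p) ≤ B ^ (-p) := Real.rpow_le_rpow_of_nonpos hB h (by linarith)
    calc A ^ (-p) * B ^ (-q) ≤ B ^ (-p) * B ^ (-q) := by gcongr
      _ = B ^ (-(p + q)) := by rw [← Real.rpow_add hB]; congr 1; ring
      _ ≤ _ := by linarith [Real.rpow_nonneg hA.le (-(p + q))]

lemma aux_max (A B M t : ℝ) (hA : 0 < A) (hB : 0 < B) (hM : 0 < M) (ht : 0 ≤ t)
    (h : M ≤ 2 * (A + B)) : M ^ t ≤ 4 ^ t * (A ^ t + B ^ t) := by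
  rw [mul_add, ← Real.mul_rpow (by norm_num) hA.le, ← Real.mul_rpow (by norm_num) hB.le]
  rcases le_total A B with h' | h'
  · have : M ^ t ≤ (4 * B) ^ t := Real.rpow_le_rpow hM.le (by linarith) ht
    have : 0 ≤ (4 * A) ^ t := by positivity
    linarith
  · have : M ^ t ≤ (4 * A) ^ t := Real.rpow_le_rpow hM.le (by linarith) ht
    have : 0 ≤ (4 * B) ^ t := by positivity
    linarith

lemma aux_term (a b : ℝ) (ha : 0 ≤ a) (hab : a < b) (hb : b < 1) (m l : ℤ × ℤ) :
    (1 + nsq (m - l)) ^ (-1 : ℝ) * (1 + nsq l) ^ (a - 1) ≤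
      (2 * 4 ^ (1 - b) * (1 + nsq m) ^ (b - 1)) *
        ((1 + nsq (m - l)) ^ (-(1 + (b - a))) + (1 + nsq l) ^ (-(1 + (b - a)))) := by
  have hM : 1 + nsq m ≤ 2 * ((1 + nsq (m - l)) + (1 + nsq l)) := by
    simp only [nsq, Prod.fst_sub, Prod.snd_sub, Int.cast_sub]
    nlinarith [sq_nonneg ((m.1 : ℝ) - 2 * l.1), sq_nonneg ((m.2 : ℝ) - 2 * l.2)]
  have hA := aux_pos (m - l)
  have hB := aux_pos l
  have hMp := aux_pos m
  generalize 1 + nsq (m - l) = A at *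
  generalize 1 + nsq l = B at *
  generalize 1 + nsq m = M at *
  have h1 := aux_max A B M (1 - b) hA hB hMp (by linarith) hM
  have h2 := aux_young A B b (1 - a) hA hB (by linarith) (by linarith)
  have h3 := aux_young A B 1 (b - a) hA hB (by linarith) (by linarith)
  have e2 : b + (1 - a) = 1 + (b - a) := by ring
  rw [e2] at h2
  set S := A ^ (-(1 + (b - a))) + B ^ (-(1 + (b - a))) with hS
  have hMM : M ^ (b - 1) * M ^ (1 - b) = 1 := by
    rw [← Real.rpow_add hMp]; simp
  have k1 : A ^ (-1 : ℝ) * B ^ (a - 1) * A ^ (1 - b) = A ^ (-b) * B ^ (-(1 - a)) := by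
    rw [mul_right_comm, ← Real.rpow_add hA]; congr 2 <;> ring
  have k2 : A ^ (-1 : ℝ) * B ^ (a - 1) * B ^ (1 - b) = A ^ (-1 : ℝ) * B ^ (-(b - a)) := by
    rw [mul_assoc, ← Real.rpow_add hB]; congr 2; ring
  have key : A ^ (-1 : ℝ) * B ^ (a - 1) * M ^ (1 - b) ≤ 4 ^ (1 - b) * (2 * S) := by
    calc A ^ (-1 : ℝ) * B ^ (a - 1) * M ^ (1 - b)
        ≤ A ^ (-1 : ℝ) * B ^ (a - 1) * (4 ^ (1 - b) * (A ^ (1 - b) + B ^ (1 - b))) := by gcongr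
      _ = 4 ^ (1 - b) * (A ^ (-1 : ℝ) * B ^ (a - 1) * A ^ (1 - b) +
            A ^ (-1 : ℝ) * B ^ (a - 1) * B ^ (1 - b)) := by ring
      _ ≤ 4 ^ (1 - b) * (2 * S) := by
        rw [k1, k2]; gcongr; linarith
  calc A ^ (-1 : ℝ) * B ^ (a - 1)
      = M ^ (b - 1) * (A ^ (-1 : ℝ) * B ^ (a - 1) * M ^ (1 - b)) := by
        linear_combination (- (A ^ (-1 : ℝ) * B ^ (a - 1))) * hMM
    _ ≤ M ^ (b - 1) * (4 ^ (1 - b) * (2 * S)) := by gcongr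
    _ = _ := by ring

/-- The key convolution estimate. -/
lemma aux_key (a b : ℝ) (ha : 0 ≤ a) (hab : a < b) (hb : b < 1) :
    ∃ C : ℝ, 0 < C ∧ ∀ m : ℤ × ℤ,
      Summable (fun l : ℤ × ℤ => (1 + nsq (m - l)) ^ (-1 : ℝ) * (1 + nsq l) ^ (a - 1)) ∧
      ∑' l : ℤ × ℤ, (1 + nsq (m - l)) ^ (-1 : ℝ) * (1 + nsq l) ^ (a - 1)
        ≤ C * (1 + nsq m) ^ (b - 1) := by
  have hs := aux_sum (1 + (b - a)) (by linarith)
  set T := ∑' l : ℤ × ℤ, (1 + nsq l) ^ (-(1 + (b - a))) with hT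
  have hT0 : 0 ≤ T := tsum_nonneg fun l => Real.rpow_nonneg (aux_pos l).le _
  refine ⟨2 * 4 ^ (1 - b) * (T + T + 1), by positivity, fun m => ?_⟩
  have hs' : Summable (fun l : ℤ × ℤ => (1 + nsq (m - l)) ^ (-(1 + (b - a)))) :=
    (Equiv.subLeft m).summable_iff.mpr hs
  have hT' : ∑' l : ℤ × ℤ, (1 + nsq (m - l)) ^ (-(1 + (b - a))) = T :=
    (Equiv.subLeft m).tsum_eq (fun l => (1 + nsq l) ^ (-(1 + (b - a))))
  have hbig := (hs'.add hs).mul_left (2 * 4 ^ (1 - b) * (1 + nsq m) ^ (b - 1))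
  have hsum : Summable
      (fun l : ℤ × ℤ => (1 + nsq (m - l)) ^ (-1 : ℝ) * (1 + nsq l) ^ (a - 1)) :=
    Summable.of_nonneg_of_le
      (fun l => mul_nonneg (Real.rpow_nonneg (aux_pos _).le _) (Real.rpow_nonneg (aux_pos _).le _))
      (fun l => aux_term a b ha hab hb m l) hbig
  refine ⟨hsum, (hsum.tsum_le_tsum (fun l => aux_term a b ha hab hb m l) hbig).trans ?_⟩
  rw [tsum_mul_left, hs'.tsum_add hs, hT', ← hT]
  have h0 : 0 ≤ (2 : ℝ) * 4 ^ (1 - b) * (1 + nsq m) ^ (b - 1) :=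
    mul_nonneg (by positivity) (Real.rpow_nonneg (aux_pos m).le _)
  nlinarith

/-- The kernel. -/
noncomputable def K0 : ℤ × ℤ → ℝ := fun m => (1 + nsq m) ^ (-1 : ℝ)

lemma K0_nonneg (m : ℤ × ℤ) : 0 ≤ K0 m := Real.rpow_nonneg (aux_pos m).le _

/-- Comparison: a nonnegative function bounded by a power. -/
lemma aux_conv (a b : ℝ) (ha : 0 ≤ a) (hab : a < b) (hb : b < 1) :
    ∃ C : ℝ, 0 < C ∧ ∀ (D : ℝ) (f : ℤ × ℤ → ℝ), (∀ l, 0 ≤ f l) →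
      (∀ l, f l ≤ D * (1 + nsq l) ^ (a - 1)) → ∀ m : ℤ × ℤ,
      Summable (fun l : ℤ × ℤ => K0 (m - l) * f l) ∧
      ∑' l : ℤ × ℤ, K0 (m - l) * f l ≤ D * (C * (1 + nsq m) ^ (b - 1)) := by
  obtain ⟨C, hC, h⟩ := aux_key a b ha hab hb
  refine ⟨C, hC, fun D f hf0 hf m => ?_⟩
  obtain ⟨h1, h2⟩ := h m
  have hD : 0 ≤ D := by
    have := (hf0 0).trans (hf 0)
    exact nonneg_of_mul_nonneg_left this (Real.rpow_pos_of_pos (aux_pos 0) _)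
  have hle : ∀ l, K0 (m - l) * f l ≤
      D * ((1 + nsq (m - l)) ^ (-1 : ℝ) * (1 + nsq l) ^ (a - 1)) := fun l => by
    have := mul_le_mul_of_nonneg_left (hf l) (K0_nonneg (m - l))
    calc _ ≤ _ := this
      _ = _ := by unfold K0; ring
  have hs : Summable (fun l : ℤ × ℤ => K0 (m - l) * f l) :=
    Summable.of_nonneg_of_le (fun l => mul_nonneg (K0_nonneg _) (hf0 l)) hle (h1.mul_left D)
  refine ⟨hs, (hs.tsum_le_tsum hle (h1.mul_left D)).trans ?_⟩
  rw [tsum_mul_left]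
  exact mul_le_mul_of_nonneg_left h2 hD

lemma iterConv_nonneg (n : ℕ) (m : ℤ × ℤ) : 0 ≤ iterConv K0 (n + 1) m := by
  induction n generalizing m with
  | zero => exact K0_nonneg m
  | succ k ih => exact tsum_nonneg fun l => mul_nonneg (K0_nonneg _) (ih l)

lemma iterConv_bound (n : ℕ) : ∀ b : ℝ, 0 < b → b < 1 → ∃ C : ℝ, 0 < C ∧ ∀ m : ℤ × ℤ,
    iterConv K0 (n + 1) m ≤ C * (1 + nsq m) ^ (b - 1) := by
  induction n with
  | zero =>
    intro b hb hb1
    refine ⟨1, one_pos, fun m => ?_⟩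
    rw [one_mul]
    exact Real.rpow_le_rpow_of_exponent_le (aux_one_le m) (by linarith)
  | succ k ih =>
    intro b hb hb1
    obtain ⟨D, hD, hf⟩ := ih (b / 2) (by linarith) (by linarith)
    obtain ⟨C, hC, h⟩ := aux_conv (b / 2) b (by linarith) (by linarith) hb1
    refine ⟨D * C, by positivity, fun m => ?_⟩
    rw [mul_assoc]
    exact (h D _ (iterConv_nonneg k) hf m).2

lemma iterConv_summable (n : ℕ) (m : ℤ × ℤ) :
    Summable (fun l : ℤ × ℤ => K0 (m - l) * iterConv K0 (n + 1) l) := by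
  obtain ⟨D, hD, hf⟩ := iterConv_bound n (1 / 3) (by norm_num) (by norm_num)
  obtain ⟨C, hC, h⟩ := aux_conv (1 / 3) (1 / 2) (by norm_num) (by norm_num) (by norm_num)
  exact (h D _ (iterConv_nonneg n) hf m).1

lemma iterConvLE_bounds (N n : ℕ) (m : ℤ × ℤ) :
    0 ≤ iterConvLE N K0 (n + 1) m ∧ iterConvLE N K0 (n + 1) m ≤ iterConv K0 (n + 1) m := by
  induction n generalizing m with
  | zero => exact ⟨K0_nonneg m, le_rfl⟩
  | succ k ih =>
    have h0 : ∀ l, 0 ≤ Set.indicator {l : ℤ × ℤ | norm2 l ≤ (N : ℝ)}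
        (fun l => K0 (m - l) * iterConvLE N K0 (k + 1) l) l := fun l =>
      Set.indicator_nonneg (fun l _ => mul_nonneg (K0_nonneg _) (ih l).1) l
    have h1 : ∀ l, Set.indicator {l : ℤ × ℤ | norm2 l ≤ (N : ℝ)}
        (fun l => K0 (m - l) * iterConvLE N K0 (k + 1) l) l
          ≤ K0 (m - l) * iterConv K0 (k + 1) l := fun l =>
      (Set.indicator_le_self' (fun l _ => mul_nonneg (K0_nonneg _) (ih l).1) l).trans
        (mul_le_mul_of_nonneg_left (ih l).2 (K0_nonneg _))
    have hs := iterConv_summable k m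
    exact ⟨tsum_nonneg h0, (Summable.of_nonneg_of_le h0 h1 hs).tsum_le_tsum h1 hs⟩

lemma aux_tail (n : ℕ) (lam : ℝ) (hlam : 0 < lam) : ∀ ε : ℝ, 0 < ε → lam + ε < 1 →
    ∃ C : ℝ, 0 < C ∧ ∀ (N : ℕ) (m : ℤ × ℤ),
      iterConvGT N K0 (n + 1) m
        ≤ C * (1 + (N : ℝ) ^ 2) ^ (-lam) * (1 + nsq m) ^ (lam + ε - 1) := by
  induction n with
  | zero =>
    intro ε hε h
    refine ⟨1, one_pos, fun N m => ?_⟩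
    have : iterConvGT N K0 (0 + 1) m = 0 := sub_self _
    rw [this]
    have := Real.rpow_nonneg (aux_pos m).le (lam + ε - 1)
    positivity
  | succ k ih =>
    intro ε hε hsum
    obtain ⟨D, hD, hf⟩ := ih (ε / 2) (by linarith) (by linarith)
    obtain ⟨E, hE, hg⟩ := iterConv_bound k (ε / 2) (by linarith) (by linarith)
    obtain ⟨C, hC, h⟩ := aux_conv (lam + ε / 2) (lam + ε) (by linarith) (by linarith) hsum
    refine ⟨(D + E) * C, by positivity, fun N m => ?_⟩
    set S : Set (ℤ × ℤ) := {l : ℤ × ℤ | norm2 l ≤ (N : ℝ)} with hS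
    set F : ℤ × ℤ → ℝ := fun l =>
      iterConv K0 (k + 1) l - S.indicator (iterConvLE N K0 (k + 1)) l with hF
    have hF0 : ∀ l, 0 ≤ F l := fun l => by
      by_cases hl : l ∈ S
      · simp only [hF, Set.indicator_of_mem hl]; linarith [(iterConvLE_bounds N k l).2]
      · simp only [hF, Set.indicator_of_notMem hl]; linarith [iterConv_nonneg k l]
    have hN : (0 : ℝ) < 1 + (N : ℝ) ^ 2 := by positivity
    have hF1 : ∀ l, F l ≤ ((D + E) * (1 + (N : ℝ) ^ 2) ^ (-lam)) *
        (1 + nsq l) ^ (lam + ε / 2 - 1) := fun l => by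
      have hp := Real.rpow_nonneg (aux_pos l).le (lam + ε / 2 - 1)
      have hq := Real.rpow_nonneg hN.le (-lam)
      by_cases hl : l ∈ S
      · simp only [hF, Set.indicator_of_mem hl]
        refine (hf N l).trans ?_
        gcongr
        linarith
      · simp only [hF, Set.indicator_of_notMem hl, sub_zero]
        refine (hg l).trans ?_
        have hlt : (N : ℝ) < norm2 l := not_le.mp hl
        have hle : 1 + (N : ℝ) ^ 2 ≤ 1 + nsq l := by
          have := (Real.lt_sqrt (by positivity)).mp hlt
          linarith
        have e : (1 + nsq l) ^ (ε / 2 - 1) =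
            (1 + nsq l) ^ (-lam) * (1 + nsq l) ^ (lam + ε / 2 - 1) := by
          rw [← Real.rpow_add (aux_pos l)]; congr 1; ring
        have h3 : (1 + nsq l) ^ (-lam) ≤ (1 + (N : ℝ) ^ 2) ^ (-lam) :=
          Real.rpow_le_rpow_of_nonpos hN hle (by linarith)
        rw [e, ← mul_assoc]
        have h4 := Real.rpow_nonneg (aux_pos l).le (-lam)
        gcongr
        linarith
    obtain ⟨_, h2⟩ := h _ F hF0 hF1 m
    have hs := iterConv_summable k m
    have hs2 : Summable (S.indicator (fun l => K0 (m - l) * iterConvLE N K0 (k + 1) l)) := by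
      refine Summable.of_nonneg_of_le (fun l => ?_) (fun l => ?_) hs
      · exact Set.indicator_nonneg
          (fun l _ => mul_nonneg (K0_nonneg _) (iterConvLE_bounds N k l).1) l
      · exact (Set.indicator_le_self' (fun l _ =>
          mul_nonneg (K0_nonneg _) (iterConvLE_bounds N k l).1) l).trans
          (mul_le_mul_of_nonneg_left (iterConvLE_bounds N k l).2 (K0_nonneg _))
    have heq : iterConvGT N K0 (k + 1 + 1) m = ∑' l : ℤ × ℤ, K0 (m - l) * F l := by
      have : iterConvGT N K0 (k + 1 + 1) m =
        (∑' l : ℤ × ℤ, K0 (m - l) * iterConv K0 (k + 1) l) -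
          ∑' l : ℤ × ℤ, S.indicator (fun l => K0 (m - l) * iterConvLE N K0 (k + 1) l) l := rfl
      rw [this, ← hs.tsum_sub hs2]
      refine tsum_congr fun l => ?_
      by_cases hl : l ∈ S
      · simp only [hF, Set.indicator_of_mem hl]; ring
      · simp only [hF, Set.indicator_of_notMem hl]; ring
    rw [heq]
    refine h2.trans (le_of_eq ?_)
    ring

theorem stmt_12 (n : ℕ) (hn : 2 ≤ n) (lam ε : ℝ) (hlam : 0 < lam) (hε : 0 < ε)
    (hsum : lam + ε < 1) :
    ∃ C : ℝ, 0 < C ∧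
      ∀ N : ℕ, 1 ≤ N → ∀ m : ℤ × ℤ,
        iterConvGT N (fun m => (1 + nsq m) ^ (-1 : ℝ)) n m
          ≤ C * (1 + (N : ℝ) ^ 2) ^ (-lam) * (1 + nsq m) ^ (lam + ε - 1) := by
  obtain ⟨k, rfl⟩ : ∃ k, n = k + 1 := ⟨n - 1, by omega⟩
  obtain ⟨C, hC, h⟩ := aux_tail k lam hlam ε hε hsum
  exact ⟨C, hC, fun N _ m => h N m⟩
end
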